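/- Let (X,C) be a strongly ordered separable Banach space and let F₀ : X → X be a compact C¹ map such that for every x ∈ X the Fréchet derivative DF₀(x) is strongly positive (i.e. DF₀(x)v ≫ 0 whenever v > 0). Assume F₀ is pointwise dissipative (hence has an attractor A). Then the set S₀ := {x ∈ X : λ_max(x,F₀) > 0} is shy in X. -/

import Mathlib

open Filter Topology MeasureTheory Set Bornology Metric
open scoped ENNReal NNReal

noncomputable section

section Defs

variable {X : Type*} [NormedAddCommGroup X] [NormedSpace ℝ X]

/-- A cone in a Banach space: a closed convex set with `r • C ⊆ C` for all `r > 0`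
and `C ∩ (-C) = {0}`. -/
def IsCone (C : Set X) : Prop :=
  IsClosed C ∧ Convex ℝ C ∧ (∀ r : ℝ, 0 < r → ∀ x ∈ C, r • x ∈ C) ∧ C ∩ (-C) = {0}

/-- `(X, C)` is strongly ordered: `C` is a cone with nonempty interior. -/
def StronglyOrderedCone (C : Set X) : Prop :=
  IsCone C ∧ (interior C).Nonempty

/-- `x < y` in the order induced by the cone `C`. -/
def coneLT (C : Set X) (x y : X) : Prop := y - x ∈ C \ {0}

/-- `x ≤ y` in the order induced by the cone `C`. -/
def coneLE (C : Set X) (x y : X) : Prop := y - x ∈ C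

/-- `x ≪ y` in the order induced by the cone `C`. -/
def coneLLT (C : Set X) (x y : X) : Prop := y - x ∈ interior C

/-- A bounded linear operator is strongly positive (w.r.t. the cone `C`) if
`T v ≫ 0` whenever `v > 0`. -/
def StronglyPositive (C : Set X) (T : X →L[ℝ] X) : Prop :=
  ∀ v : X, v ∈ C \ {0} → T v ∈ interior C

/-- A map between normed spaces is compact if it sends bounded sets to relatively
compact sets. -/
def IsCompactMap {Y Z : Type*} [NormedAddCommGroup Y] [NormedAddCommGroup Z]
    (f : Y → Z) : Prop :=
  ∀ B : Set Y, IsBounded B → IsCompact (closure (f '' B))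

/-- `h` is pointwise dissipative: some nonempty bounded set `B` attracts every point. -/
def PointwiseDissipative (h : X → X) : Prop :=
  ∃ B : Set X, B.Nonempty ∧ IsBounded B ∧
    ∀ x : X, Tendsto (fun n : ℕ => infDist (h^[n] x) B) atTop (nhds 0)

/-- The set `A` attracts the set `B` under iteration of `h`. -/
def AttractsSet (h : X → X) (A B : Set X) : Prop :=
  ∀ ε : ℝ, 0 < ε → ∃ N : ℕ, ∀ n : ℕ, N ≤ n → ∀ x ∈ B, infDist (h^[n] x) A < ε

/-- `A` is an attractor of `h`: the maximal compact invariant set attracting every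
bounded set. -/
def IsAttractor (h : X → X) (A : Set X) : Prop :=
  A.Nonempty ∧ IsCompact A ∧ h '' A = A ∧
    (∀ B : Set X, IsBounded B → AttractsSet h A B) ∧
    (∀ A' : Set X, IsCompact A' → h '' A' = A' → A' ⊆ A)

/-- The ω-limit set `ω(x,h) = ⋂ₖ closure {hⁿ x : n ≥ k}`. -/
def omegaMap (h : X → X) (x : X) : Set X :=
  ⋂ k : ℕ, closure {y : X | ∃ n : ℕ, k ≤ n ∧ y = h^[n] x}

/-- The largest Lyapunov exponent `λ_max(x,h) = liminf (log ‖Dhⁿ(x)‖)/n` (in `EReal`). -/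
def lambdaMax (h : X → X) (x : X) : EReal :=
  atTop.liminf fun n : ℕ => ((Real.log ‖fderiv ℝ (h^[n]) x‖ / n : ℝ) : EReal)

/-- The principal Lyapunov exponent `λ₁(x,h) = limsup (log ‖Dhⁿ(x)‖)/n` (in `EReal`). -/
def lambdaOne (h : X → X) (x : X) : EReal :=
  atTop.limsup fun n : ℕ => ((Real.log ‖fderiv ℝ (h^[n]) x‖ / n : ℝ) : EReal)

/-- `S` is a linearly stable cycle of `h` of minimal period `p`: `S` is the orbit of a
`p`-periodic point `z` with spectral radius of `Dhᵖ(z)` at most `1`. -/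
def IsLinStableCycle (h : X → X) (p : ℕ) (S : Set X) : Prop :=
  ∃ z : X, h^[p] z = z ∧ (∀ l : ℕ, 0 < l → l < p → h^[l] z ≠ z) ∧
    spectralRadius ℝ (fderiv ℝ (h^[p]) z) ≤ 1 ∧ S = {y : X | ∃ n : ℕ, y = h^[n] z}

/-- `S` is a linearly stable cycle of `h` of minimal period at most `m`. -/
def IsLinStableCycleLe (h : X → X) (m : ℕ) (S : Set X) : Prop :=
  ∃ p : ℕ, 0 < p ∧ p ≤ m ∧ IsLinStableCycle h p S

/-- Semiflow axioms for `Φ : ℝ → X → X` (restricted to nonnegative times). -/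
def IsSemiflow (Φ : ℝ → X → X) : Prop :=
  (∀ x : X, Φ 0 x = x) ∧
    (∀ s t : ℝ, 0 ≤ s → 0 ≤ t → ∀ x : X, Φ (t + s) x = Φ t (Φ s x)) ∧
    ContinuousOn (fun p : ℝ × X => Φ p.1 p.2) (Ici (0 : ℝ) ×ˢ (univ : Set X))

/-- The ω-limit set of `x` under a semiflow. -/
def omegaFlow (Φ : ℝ → X → X) (x : X) : Set X :=
  ⋂ s : ℝ, closure {y : X | ∃ t : ℝ, s ≤ t ∧ y = Φ t x}

/-- The largest Lyapunov exponent of `x` w.r.t. a semiflow. -/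
def lambdaMaxFlow (Φ : ℝ → X → X) (x : X) : EReal :=
  atTop.liminf fun t : ℝ => ((Real.log ‖fderiv ℝ (Φ t) x‖ / t : ℝ) : EReal)

/-- The principal Lyapunov exponent of `x` w.r.t. a semiflow. -/
def lambdaOneFlow (Φ : ℝ → X → X) (x : X) : EReal :=
  atTop.limsup fun t : ℝ => ((Real.log ‖fderiv ℝ (Φ t) x‖ / t : ℝ) : EReal)

end Defs

section Shy

variable {X : Type*} [NormedAddCommGroup X] [NormedSpace ℝ X] [MeasurableSpace X]

/-- A Borel set `W` is shy if there is a nonzero compactly supported Borel measure `μ`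
with `μ(x + W) = 0` for every `x`. -/
def IsShy (W : Set X) : Prop :=
  MeasurableSet W ∧
    ∃ μ : Measure X, μ ≠ 0 ∧ (∃ K : Set X, IsCompact K ∧ μ Kᶜ = 0) ∧
      ∀ x : X, μ ((fun w => x + w) '' W) = 0

/-- `W` is prevalent in `V` if `V \ W` is shy. -/
def IsPrevalentIn (V W : Set X) : Prop := IsShy (V \ W)

end Shy

/-- Every orbit of a pointwise dissipative map is bounded. -/
lemma PointwiseDissipative.isBounded_orbit {X : Type*} [NormedAddCommGroup X] {F : X → X}
    (h : PointwiseDissipative F) (x : X) :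
    IsBounded (range fun n : ℕ => F^[n] x) := by
  obtain ⟨B, hne, hB, hlim⟩ := h
  obtain ⟨N, hN⟩ := eventually_atTop.1 ((hlim x).eventually (gt_mem_nhds zero_lt_one))
  refine ((hB.thickening (δ := 1)).union
    ((Finset.range N).finite_toSet.image fun n => F^[n] x).isBounded).subset ?_
  rintro _ ⟨n, rfl⟩
  by_cases hn : N ≤ n
  · left
    exact (mem_thickening_iff_infDist_lt hne).2 (hN n hn)
  · right
    exact ⟨n, by simpa using hn, rfl⟩

section ConeMaps

variable {X : Type*} [NormedAddCommGroup X] [NormedSpace ℝ X]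

lemma IsCone.zero_mem {C : Set X} (hC : IsCone C) : (0 : X) ∈ C := by
  have h : (0 : X) ∈ C ∩ (-C) := by rw [hC.2.2.2]; rfl
  exact h.1

lemma IsCone.add_mem {C : Set X} (hC : IsCone C) {x y : X} (hx : x ∈ C) (hy : y ∈ C) :
    x + y ∈ C := by
  have h := hC.2.1 hx hy (by norm_num : (0 : ℝ) ≤ 1 / 2) (by norm_num : (0 : ℝ) ≤ 1 / 2)
    (by norm_num)
  have h2 := hC.2.2.1 2 (by norm_num) _ h
  rwa [smul_add, smul_smul, smul_smul, mul_one_div_cancel (two_ne_zero' ℝ), one_smul,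
    one_smul] at h2

/-- A vector interior to a cone dominates a multiple of the unit ball. -/
lemma IsCone.exists_add_smul_mem {C : Set X} (hC : IsCone C) {e : X} (he : e ∈ interior C) :
    ∃ M : ℝ, 0 < M ∧ ∀ w : X, ‖w‖ ≤ 1 → w + M • e ∈ C := by
  obtain ⟨r, hr, hball⟩ := Metric.isOpen_iff.1 isOpen_interior e he
  refine ⟨2 / r, by positivity, fun w hw => ?_⟩
  have hmem : e + (r / 2) • w ∈ C := by
    refine interior_subset (hball ?_)
    rw [mem_ball, dist_eq_norm, add_sub_cancel_left, norm_smul, Real.norm_of_nonneg (by positivity)]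
    nlinarith [norm_nonneg w]
  have h := hC.2.2.1 (2 / r) (by positivity) _ hmem
  rw [smul_add, smul_smul, show 2 / r * (r / 2) = 1 by field_simp, one_smul] at h
  rwa [add_comm]

lemma IsCone.zero_notMem_interior [Nontrivial X] {C : Set X} (hC : IsCone C) :
    (0 : X) ∉ interior C := by
  intro h0
  obtain ⟨x, hx⟩ := exists_ne (0 : X)
  obtain ⟨M, -, hM⟩ := hC.exists_add_smul_mem h0
  have hn : ‖(‖x‖⁻¹ • x)‖ ≤ 1 := by
    rw [norm_smul, norm_inv, norm_norm, inv_mul_cancel₀ (norm_ne_zero_iff.2 hx)]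
  have h1 := hM _ hn
  have h2 := hM _ ((norm_neg _).trans_le hn)
  rw [smul_zero, add_zero] at h1 h2
  have h3 : ‖x‖⁻¹ • x ∈ C ∩ (-C) := ⟨h1, h2⟩
  rw [hC.2.2.2, mem_singleton_iff, smul_eq_zero] at h3
  simp [hx] at h3

/-- A solid cone in a nontrivial space has a continuous linear functional which is positive on
its interior and nonnegative on the cone. -/
lemma StronglyOrderedCone.exists_positive_functional [Nontrivial X] {C : Set X}
    (hC : StronglyOrderedCone C) :
    ∃ l : X →L[ℝ] ℝ, (∀ x ∈ interior C, 0 < l x) ∧ ∀ x ∈ C, 0 ≤ l x := by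
  obtain ⟨f, hf⟩ := geometric_hahn_banach_open_point hC.1.2.1.interior isOpen_interior
    hC.1.zero_notMem_interior
  have hpos : ∀ x ∈ interior C, 0 < (-f) x := fun x hx => by simpa using hf x hx
  refine ⟨-f, hpos, fun x hx => ?_⟩
  have hx' : x ∈ closure (interior C) := by
    rw [hC.1.2.1.closure_interior_eq_closure_of_nonempty_interior hC.2]
    exact subset_closure hx
  exact closure_minimal (fun y hy => (hpos y hy).le)
    (isClosed_le continuous_const (-f).continuous) hx'

lemma StronglyPositive.mapsTo {C : Set X} (hC : IsCone C) {T : X →L[ℝ] X}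
    (hT : StronglyPositive C T) {v : X} (hv : v ∈ C) : T v ∈ C := by
  by_cases h : v = 0
  · rw [h, map_zero]; exact hC.zero_mem
  · exact interior_subset (hT v ⟨hv, h⟩)

lemma fderiv_iterate_succ {F : X → X} (hF : Differentiable ℝ F) (n : ℕ) (x : X) :
    fderiv ℝ (F^[n + 1]) x = (fderiv ℝ F (F^[n] x)).comp (fderiv ℝ (F^[n]) x) := by
  rw [Function.iterate_succ']
  exact fderiv_comp x (hF _) (hF.iterate n x)

lemma fderiv_iterate_mem {C : Set X} (hC : IsCone C) {F : X → X} (hF : Differentiable ℝ F)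
    (hpos : ∀ x : X, StronglyPositive C (fderiv ℝ F x)) (n : ℕ) (x : X) {v : X} (hv : v ∈ C) :
    fderiv ℝ (F^[n]) x v ∈ C := by
  induction n with
  | zero => simpa using hv
  | succ n ih =>
    rw [fderiv_iterate_succ hF]
    exact (hpos _).mapsTo hC ih

/-- The derivatives of a compact `C¹` map along a compact set are collectively compact. -/
lemma IsCompactMap.totallyBounded_fderiv {F : X → X} (hF : ContDiff ℝ 1 F)
    (hcpt : IsCompactMap F) {K : Set X} (hK : IsCompact K) :
    TotallyBounded {p : X | ∃ y ∈ K, ∃ u : X, ‖u‖ ≤ 1 ∧ p = fderiv ℝ F y u} := by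
  have hsingle : ∀ y : X, TotallyBounded ((fun u => fderiv ℝ F y u) '' closedBall 0 1) := by
    intro y
    rw [Metric.totallyBounded_iff]
    intro ε hε
    have hd := ((hF.differentiable one_ne_zero) y).hasFDerivAt.isLittleO.bound
      (by positivity : 0 < ε / 2)
    obtain ⟨r, hr, hball⟩ := Metric.eventually_nhds_iff.1 hd
    have htb : TotallyBounded (F '' closedBall y (r / 2)) :=
      (hcpt _ isBounded_closedBall).totallyBounded.subset subset_closure
    have htb' := htb.image (f := fun p => (r / 2)⁻¹ • (p - F y))
      (((uniformContinuous_id.sub uniformContinuous_const).const_smul _))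
    obtain ⟨t, ht, hcov⟩ := Metric.totallyBounded_iff.1 htb' (ε / 2) (by positivity)
    refine ⟨t, ht, ?_⟩
    rintro _ ⟨u, hu, rfl⟩
    rw [mem_closedBall_zero_iff] at hu
    have hdist : dist (y + (r / 2) • u) y ≤ r / 2 := by
      rw [dist_eq_norm, add_sub_cancel_left, norm_smul, Real.norm_of_nonneg (by positivity)]
      nlinarith
    have hq : (r / 2)⁻¹ • (F (y + (r / 2) • u) - F y) ∈
        (fun p => (r / 2)⁻¹ • (p - F y)) '' (F '' closedBall y (r / 2)) :=
      ⟨_, ⟨_, hdist, rfl⟩, rfl⟩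
    obtain ⟨c, hc, hcq⟩ := mem_iUnion₂.1 (hcov hq)
    refine mem_iUnion₂.2 ⟨c, hc, ?_⟩
    have hb := hball (y := y + (r / 2) • u) (by linarith)
    rw [add_sub_cancel_left, map_smul] at hb
    have hclose : dist (fderiv ℝ F y u) ((r / 2)⁻¹ • (F (y + (r / 2) • u) - F y)) ≤ ε / 2 := by
      have heq : fderiv ℝ F y u - (r / 2)⁻¹ • (F (y + (r / 2) • u) - F y) =
          -((r / 2)⁻¹ • (F (y + (r / 2) • u) - F y - (r / 2) • fderiv ℝ F y u)) := by
        rw [smul_sub _ _ ((r / 2) • _), smul_smul, inv_mul_cancel₀ (by positivity), one_smul]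
        abel
      have hu' : ‖(r / 2) • u‖ ≤ r / 2 := by
        rw [norm_smul, Real.norm_of_nonneg (by positivity)]
        nlinarith
      rw [dist_eq_norm, heq, norm_neg, norm_smul, norm_inv, Real.norm_of_nonneg (by positivity),
        inv_mul_le_iff₀ (by positivity)]
      nlinarith
    rw [mem_ball] at hcq ⊢
    linarith [dist_triangle (fderiv ℝ F y u) ((r / 2)⁻¹ • (F (y + (r / 2) • u) - F y)) c]
  rw [Metric.totallyBounded_iff]
  intro ε hε
  have hcont := hF.continuous_fderiv one_ne_zero
  obtain ⟨s, -, hsK⟩ := hK.elim_nhds_subcover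
    (fun y => {y' | dist (fderiv ℝ F y') (fderiv ℝ F y) < ε / 2})
    (fun y _ => hcont.continuousAt.eventually (Metric.ball_mem_nhds _ (by positivity)))
  have hfin : TotallyBounded (⋃ y ∈ s, (fun u => fderiv ℝ F y u) '' closedBall 0 1) :=
    (totallyBounded_biUnion s.finite_toSet).2 fun y _ => hsingle y
  obtain ⟨t, ht, hcov⟩ := Metric.totallyBounded_iff.1 hfin (ε / 2) (by positivity)
  refine ⟨t, ht, ?_⟩
  rintro _ ⟨y, hy, u, hu, rfl⟩
  obtain ⟨y', hy', hyy'⟩ := mem_iUnion₂.1 (hsK hy)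
  obtain ⟨c, hc, hcu⟩ := mem_iUnion₂.1 (hcov (mem_iUnion₂.2
    ⟨y', hy', u, mem_closedBall_zero_iff.2 hu, rfl⟩))
  refine mem_iUnion₂.2 ⟨c, hc, ?_⟩
  have hop : dist (fderiv ℝ F y u) (fderiv ℝ F y' u) ≤
      dist (fderiv ℝ F y) (fderiv ℝ F y') := by
    rw [dist_eq_norm, dist_eq_norm, ← sub_apply]
    exact (ContinuousLinearMap.le_opNorm _ _).trans (mul_le_of_le_one_right (norm_nonneg _) hu)
  rw [mem_ofPred_eq] at hyy'
  rw [mem_ball] at hcu ⊢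
  linarith [dist_triangle (fderiv ℝ F y u) (fderiv ℝ F y' u) c]

/-- Along a compact set, derivatives map the part of the cone that is not contracted too much
uniformly into the interior, as measured by a functional positive there. -/
lemma exists_pos_le_functional [CompleteSpace X] {C : Set X} (hC : IsCone C) {F : X → X}
    (hF : ContDiff ℝ 1 F) (hcpt : IsCompactMap F)
    (hpos : ∀ x : X, StronglyPositive C (fderiv ℝ F x)) {l : X →L[ℝ] ℝ}
    (hl : ∀ x ∈ interior C, 0 < l x) {K : Set X} (hK : IsCompact K) {δ : ℝ} (hδ : 0 < δ) :
    ∃ c : ℝ, 0 < c ∧ ∀ y ∈ K, ∀ y' ∈ K, ∀ u : X, ‖u‖ ≤ 1 → fderiv ℝ F y u ∈ C →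
      δ ≤ ‖fderiv ℝ F y u‖ → c ≤ l (fderiv ℝ F y' (fderiv ℝ F y u)) := by
  set S := {p : X | ∃ y ∈ K, ∃ u : X, ‖u‖ ≤ 1 ∧ p = fderiv ℝ F y u} with hS
  have hScpt : IsCompact (closure S) :=
    (hcpt.totallyBounded_fderiv hF hK).closure.isCompact_of_isClosed isClosed_closure
  have hPcpt : IsCompact (closure S ∩ (C ∩ {p | δ ≤ ‖p‖})) :=
    hScpt.inter_right (hC.1.inter (isClosed_le continuous_const continuous_norm))
  have hcont : Continuous fun q : X × X => l (fderiv ℝ F q.1 q.2) :=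
    l.continuous.comp
      (((hF.continuous_fderiv one_ne_zero).comp continuous_fst).clm_apply continuous_snd)
  have hgt : ∀ q ∈ K ×ˢ (closure S ∩ (C ∩ {p | δ ≤ ‖p‖})), 0 < l (fderiv ℝ F q.1 q.2) := by
    rintro ⟨y, p⟩ ⟨-, -, hpC, hpδ⟩
    refine hl _ (hpos y p ⟨hpC, fun h0 => ?_⟩)
    rw [mem_singleton_iff] at h0
    rw [mem_ofPred_eq, h0, norm_zero] at hpδ
    linarith
  obtain ⟨c, hc, hle⟩ : ∃ c : ℝ, 0 < c ∧
      ∀ q ∈ K ×ˢ (closure S ∩ (C ∩ {p | δ ≤ ‖p‖})), c ≤ l (fderiv ℝ F q.1 q.2) :=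
    (hK.prod hPcpt).exists_forall_le' hcont.continuousOn hgt
  exact ⟨c, hc, fun y hy y' hy' u hu huC huδ =>
    hle (y', fderiv ℝ F y u) ⟨hy', subset_closure ⟨y, hy, u, hu, rfl⟩, huC, huδ⟩⟩

/-- Whenever the norm of the derivative cocycle does not decrease, it is controlled by the
growth of a single interior vector one step later. -/
lemma exists_norm_fderiv_iterate_le [CompleteSpace X] {C : Set X} (hC : IsCone C) {F : X → X}
    (hF : ContDiff ℝ 1 F) (hcpt : IsCompactMap F)
    (hpos : ∀ x : X, StronglyPositive C (fderiv ℝ F x)) {l : X →L[ℝ] ℝ}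
    (hl : ∀ x ∈ interior C, 0 < l x) (hl' : ∀ x ∈ C, 0 ≤ l x) {e : X} (he : e ∈ interior C)
    {x : X} (hx : IsBounded (range fun n : ℕ => F^[n] x)) :
    ∃ D : ℝ, 0 < D ∧ ∀ n : ℕ, ‖fderiv ℝ (F^[n]) x‖ ≤ ‖fderiv ℝ (F^[n + 1]) x‖ →
      ‖fderiv ℝ (F^[n + 1]) x‖ ≤ D * l (fderiv ℝ (F^[n + 2]) x e) := by
  have hd := hF.differentiable one_ne_zero
  obtain ⟨M, hM, hdom⟩ := hC.exists_add_smul_mem he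
  set R := 1 + M * ‖e‖ with hR
  have hRpos : 0 < R := by positivity
  have hK : IsCompact ({x} ∪ closure (F '' range fun n : ℕ => F^[n] x)) :=
    isCompact_singleton.union (hcpt _ hx)
  have hmemK : ∀ n : ℕ, F^[n] x ∈ {x} ∪ closure (F '' range fun n : ℕ => F^[n] x) := by
    rintro (_ | n)
    · left; rfl
    · right
      exact subset_closure ⟨F^[n] x, ⟨n, rfl⟩, (Function.iterate_succ_apply' F n x).symm⟩
  obtain ⟨c, hc, hcl⟩ := exists_pos_le_functional hC hF hcpt hpos hl hK
    (by positivity : 0 < 1 / (4 * R))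
  refine ⟨2 * M / (c * R), by positivity, fun n hn => ?_⟩
  set a := ‖fderiv ℝ (F^[n + 1]) x‖ with ha
  have hlnn : 0 ≤ l (fderiv ℝ (F^[n + 2]) x e) :=
    hl' _ (fderiv_iterate_mem hC hd hpos _ _ (interior_subset he))
  rcases (norm_nonneg (fderiv ℝ (F^[n + 1]) x)).eq_or_lt with h0 | hapos
  · rw [ha, ← h0]; positivity
  rw [← ha] at hapos
  have hMe : M • e ∈ C := by simpa using hdom 0 (by simp)
  have hMe_norm : ‖M • e‖ = M * ‖e‖ := by rw [norm_smul, Real.norm_of_nonneg hM.le]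
  obtain ⟨z, hzC, hzR, hz2, hza⟩ : ∃ z ∈ C, ‖z‖ ≤ R ∧ (2 * M) • e - z ∈ C ∧
      a / 4 ≤ ‖fderiv ℝ (F^[n + 1]) x z‖ := by
    obtain ⟨w, hw1, hwa⟩ : ∃ w : X, ‖w‖ ≤ 1 ∧ a / 2 ≤ ‖fderiv ℝ (F^[n + 1]) x w‖ := by
      obtain ⟨w, hw, hwa⟩ := (fderiv ℝ (F^[n + 1]) x).exists_lt_apply_of_lt_opNorm
        (show a / 2 < ‖fderiv ℝ (F^[n + 1]) x‖ by rw [← ha]; linarith)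
      exact ⟨w, hw.le, hwa.le⟩
    by_cases h : a / 4 ≤ ‖fderiv ℝ (F^[n + 1]) x (M • e)‖
    · refine ⟨M • e, hMe, by rw [hMe_norm, hR]; linarith, ?_, h⟩
      rwa [two_mul, add_smul, add_sub_cancel_right]
    · refine ⟨w + M • e, hdom w hw1, (norm_add_le _ _).trans (by rw [hMe_norm, hR]; linarith),
        ?_, ?_⟩
      · have h' := hdom (-w) (by rwa [norm_neg])
        convert h' using 1
        rw [two_mul, add_smul]
        abel
      · rw [map_add]
        have := norm_sub_le (fderiv ℝ (F^[n + 1]) x w + fderiv ℝ (F^[n + 1]) x (M • e))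
          (fderiv ℝ (F^[n + 1]) x (M • e))
        rw [add_sub_cancel_right] at this
        linarith
  set s := (R * a)⁻¹ with hs
  have hspos : 0 < s := by positivity
  have hstep : fderiv ℝ F (F^[n] x) (s • fderiv ℝ (F^[n]) x z) =
      s • fderiv ℝ (F^[n + 1]) x z := by
    rw [fderiv_iterate_succ hd, map_smul]; rfl
  have key := hcl _ (hmemK n) _ (hmemK (n + 1)) (s • fderiv ℝ (F^[n]) x z) ?_ ?_ ?_
  · rw [hstep, map_smul, map_smul] at key
    have hcomp : fderiv ℝ F (F^[n + 1] x) (fderiv ℝ (F^[n + 1]) x z) =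
        fderiv ℝ (F^[n + 2]) x z := by
      rw [fderiv_iterate_succ hd (n + 1)]; rfl
    rw [hcomp, smul_eq_mul] at key
    have hle := hl' _ (fderiv_iterate_mem hC hd hpos (n + 2) x hz2)
    rw [map_sub, map_sub, map_smul, map_smul, smul_eq_mul] at hle
    rw [hs, inv_mul_eq_div, le_div_iff₀ (by positivity)] at key
    rw [div_mul_eq_mul_div, le_div_iff₀ (by positivity)]
    linarith
  · rw [norm_smul, Real.norm_of_nonneg hspos.le, hs, inv_mul_le_iff₀ (by positivity), mul_one,
      mul_comm]
    exact (ContinuousLinearMap.le_opNorm _ _).trans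
      (mul_le_mul hn hzR (norm_nonneg _) hapos.le)
  · rw [hstep]
    exact hC.2.2.1 s hspos _ (fderiv_iterate_mem hC hd hpos _ _ hzC)
  · rw [hstep, norm_smul, Real.norm_of_nonneg hspos.le, hs, inv_mul_eq_div,
      le_div_iff₀ (by positivity)]
    calc 1 / (4 * R) * (R * a) = a / 4 := by field_simp
      _ ≤ _ := hza

end ConeMaps

/-- A sequence whose logarithmic growth rate has positive limit inferior grows exponentially. -/
lemma exists_exp_le_of_liminf_pos {a : ℕ → ℝ} (ha : ∀ n, 0 ≤ a n)
    (h : 0 < atTop.liminf fun n : ℕ => ((Real.log (a n) / n : ℝ) : EReal)) :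
    ∃ r : ℝ, 0 < r ∧ ∀ᶠ n : ℕ in atTop, Real.exp (r * n) ≤ a n := by
  obtain ⟨r, hr0, hr⟩ := EReal.lt_iff_exists_real_btwn.1 h
  have hr0 : 0 < r := by exact_mod_cast hr0
  refine ⟨r, hr0, ?_⟩
  filter_upwards [eventually_lt_of_lt_liminf hr, eventually_gt_atTop 0] with n hn hn0
  have hn0' : (0 : ℝ) < n := by exact_mod_cast hn0
  have hlt : r * n < Real.log (a n) := (lt_div_iff₀ hn0').1 (by exact_mod_cast hn)
  have hapos : 0 < a n := by
    refine (ha n).lt_of_ne' fun h0 => ?_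
    rw [h0, Real.log_zero] at hlt
    nlinarith
  exact (Real.le_log_iff_exp_le hapos).1 hlt.le

/-- A sequence that is polynomially bounded at its ascents cannot have a positive exponential
growth rate. -/
lemma not_liminf_pos_of_ascents_le {a : ℕ → ℝ} (ha : ∀ n, 0 ≤ a n) {D : ℝ}
    (h : ∀ n, a n ≤ a (n + 1) → a (n + 1) ≤ D * ((n : ℝ) + 3) ^ 2) :
    ¬ 0 < atTop.liminf fun n : ℕ => ((Real.log (a n) / n : ℝ) : EReal) := by
  intro hpos
  obtain ⟨r, hr, hexp⟩ := exists_exp_le_of_liminf_pos ha hpos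
  have hlim : Tendsto (fun n : ℕ => Real.exp (r * n)) atTop atTop :=
    Real.tendsto_exp_atTop.comp (tendsto_natCast_atTop_atTop.const_mul_atTop hr)
  have hsmall : ∀ᶠ n : ℕ in atTop, D * ((n : ℝ) + 3) ^ 2 < Real.exp (r * (n + 1 : ℕ)) := by
    have hz : Tendsto (fun y : ℝ => D * Real.exp (2 * r) * (y ^ 2 / Real.exp (r * y)))
        atTop (𝓝 0) := by
      simpa using (isLittleO_pow_exp_pos_mul_atTop 2 hr).tendsto_div_nhds_zero.const_mul
        (D * Real.exp (2 * r))
    have hshift : Tendsto (fun n : ℕ => (n : ℝ) + 3) atTop atTop :=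
      tendsto_atTop_add_const_right _ _ tendsto_natCast_atTop_atTop
    filter_upwards [(hz.comp hshift).eventually (gt_mem_nhds zero_lt_one)] with n hn
    rw [Function.comp_apply, ← mul_div_assoc, div_lt_one (Real.exp_pos _),
      show r * ((n : ℝ) + 3) = 2 * r + r * (n + 1 : ℕ) by push_cast; ring, Real.exp_add,
      mul_right_comm, mul_comm] at hn
    exact lt_of_mul_lt_mul_left hn (Real.exp_pos _).le
  obtain ⟨N, hN⟩ := eventually_atTop.1
    (hsmall.and ((tendsto_add_atTop_nat 1).eventually hexp))
  have hdesc : ∀ n, N ≤ n → a (n + 1) ≤ a n := by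
    intro n hn
    by_contra hlt
    have := hN n hn
    linarith [h n (not_le.1 hlt).le]
  have hbdd : ∀ n, N ≤ n → a n ≤ a N := fun n hn =>
    Nat.le_induction le_rfl (fun k hk ih => (hdesc k hk).trans ih) n hn
  obtain ⟨n, hn1, hn2, hn3⟩ :=
    (hexp.and ((hlim.eventually_gt_atTop (a N)).and (eventually_ge_atTop N))).exists
  linarith [hbdd n hn3]

/-- Nonnegative functions with uniformly bounded integrals grow at most quadratically along
almost every point. -/
lemma ae_exists_le_sq_of_lintegral_le {Ω : Type*} [MeasurableSpace Ω] {ν : Measure Ω}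
    {g : ℕ → Ω → ℝ} (hg : ∀ n, Measurable (g n)) {K : ℝ≥0∞} (hK : K ≠ ∞)
    (h : ∀ n, ∫⁻ t, ENNReal.ofReal (g n t) ∂ν ≤ K) :
    ∀ᵐ t ∂ν, ∃ D : ℝ, 0 ≤ D ∧ ∀ n, g n t ≤ D * ((n : ℝ) + 1) ^ 2 := by
  set w : ℕ → ℝ≥0∞ := fun n => ENNReal.ofReal (1 / ((n : ℝ) + 1) ^ 2) with hw
  have hwsum : ∑' n, w n ≠ ∞ := by
    have hs : Summable fun n : ℕ => 1 / ((n : ℝ) + 1) ^ 2 := by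
      simpa using (summable_nat_add_iff 1).2 (Real.summable_one_div_nat_pow.2 one_lt_two)
    exact hs.tsum_ofReal_ne_top
  have hmeas : ∀ n, Measurable fun t => w n * ENNReal.ofReal (g n t) := fun n =>
    (hg n).ennreal_ofReal.const_mul _
  have hfin : ∫⁻ t, ∑' n, w n * ENNReal.ofReal (g n t) ∂ν ≠ ∞ := by
    rw [lintegral_tsum fun n => (hmeas n).aemeasurable]
    refine ne_top_of_le_ne_top (ENNReal.mul_ne_top hwsum hK) ?_
    rw [← ENNReal.tsum_mul_right]
    refine ENNReal.tsum_le_tsum fun n => ?_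
    rw [lintegral_const_mul _ (hg n).ennreal_ofReal]
    gcongr
    exact h n
  filter_upwards [ae_lt_top (Measurable.tsum hmeas) hfin] with t ht
  refine ⟨_, ENNReal.toReal_nonneg (a := ∑' n, w n * ENNReal.ofReal (g n t)), fun n => ?_⟩
  have hle := ENNReal.le_tsum (f := fun n => w n * ENNReal.ofReal (g n t)) n
  rw [hw, ← ENNReal.ofReal_mul (by positivity), ENNReal.ofReal_le_iff_le_toReal ht.ne,
    one_div_mul_eq_div, div_le_iff₀ (by positivity)] at hle
  exact hle

section Iterates

variable {X : Type*} [NormedAddCommGroup X] [NormedSpace ℝ X]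

lemma ContDiff.continuous_fderiv_iterate {F : X → X} (hF : ContDiff ℝ 1 F) (n : ℕ) :
    Continuous (fderiv ℝ (F^[n])) := by
  have h : ContDiff ℝ 1 (F^[n]) := by
    induction n with
    | zero => exact contDiff_id
    | succ n ih => exact ih.comp hF
  exact h.continuous_fderiv one_ne_zero

lemma measurable_lambdaMax [MeasurableSpace X] [BorelSpace X] {F : X → X}
    (hF : ContDiff ℝ 1 F) : Measurable (lambdaMax F) := by
  refine Measurable.liminf fun n => ?_
  exact ((Real.measurable_log.comp
    (hF.continuous_fderiv_iterate n).norm.measurable).div_const _).coe_real_ereal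

/-- Along a segment in an interior direction, the derivative cocycle applied to that direction
has bounded integrals, since it integrates to a difference of two bounded orbits. -/
lemma exists_lintegral_fderiv_iterate_le {C : Set X} (hC : IsCone C) {F : X → X}
    (hF : ContDiff ℝ 1 F) (hpos : ∀ x : X, StronglyPositive C (fderiv ℝ F x)) {l : X →L[ℝ] ℝ}
    (hl : ∀ x ∈ C, 0 ≤ l x) {e : X} (he : e ∈ C)
    (hbdd : ∀ x : X, IsBounded (range fun n : ℕ => F^[n] x)) (x : X) :
    ∃ K : ℝ≥0∞, K ≠ ∞ ∧ ∀ n, ∫⁻ t in Icc (0 : ℝ) 1,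
      ENNReal.ofReal (l (fderiv ℝ (F^[n]) (x + t • e) e)) ≤ K := by
  obtain ⟨R₀, hR₀⟩ := (hbdd x).exists_norm_le
  obtain ⟨R₁, hR₁⟩ := (hbdd (x + e)).exists_norm_le
  refine ⟨ENNReal.ofReal (‖l‖ * (R₁ + R₀)), ENNReal.ofReal_ne_top, fun n => ?_⟩
  have hcont : Continuous fun t : ℝ => l (fderiv ℝ (F^[n]) (x + t • e) e) :=
    l.continuous.comp (((hF.continuous_fderiv_iterate n).comp (by fun_prop)).clm_apply
      continuous_const)
  have hderiv : ∀ t : ℝ, HasDerivAt (fun t : ℝ => l (F^[n] (x + t • e)))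
      (l (fderiv ℝ (F^[n]) (x + t • e) e)) t := by
    intro t
    have h1 : HasDerivAt (fun t : ℝ => x + t • e) e t := by
      simpa using ((hasDerivAt_id t).smul_const e).const_add x
    exact l.hasFDerivAt.comp_hasDerivAt t
      ((((hF.differentiable one_ne_zero).iterate n) _).hasFDerivAt.comp_hasDerivAt t h1)
  have hint := intervalIntegral.integral_eq_sub_of_hasDerivAt (fun t _ => hderiv t)
    (hcont.intervalIntegrable 0 1)
  rw [← ofReal_integral_eq_lintegral_ofReal hcont.continuousOn.integrableOn_Icc
    (Eventually.of_forall fun t => hl _ (fderiv_iterate_mem hC (hF.differentiable one_ne_zero)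
      hpos _ _ he)), integral_Icc_eq_integral_Ioc, ← intervalIntegral.integral_of_le zero_le_one,
    hint, one_smul, zero_smul, add_zero, ← map_sub]
  refine ENNReal.ofReal_le_ofReal ((le_abs_self _).trans ((l.le_opNorm _).trans ?_))
  gcongr
  exact (norm_sub_le _ _).trans (add_le_add (hR₁ _ ⟨n, rfl⟩) (hR₀ _ ⟨n, rfl⟩))

/-- On almost every point of a segment in an interior direction, the largest Lyapunov exponent
is nonpositive. -/
lemma ae_not_lambdaMax_pos [CompleteSpace X] [Nontrivial X] {C : Set X}
    (hC : StronglyOrderedCone C) {F : X → X} (hF : ContDiff ℝ 1 F) (hcpt : IsCompactMap F)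
    (hpos : ∀ x : X, StronglyPositive C (fderiv ℝ F x))
    (hbdd : ∀ x : X, IsBounded (range fun n : ℕ => F^[n] x)) {e : X} (he : e ∈ interior C)
    (x : X) : ∀ᵐ t ∂(volume.restrict (Icc (0 : ℝ) 1)), ¬ 0 < lambdaMax F (x + t • e) := by
  obtain ⟨l, hl, hl'⟩ := hC.exists_positive_functional
  obtain ⟨K, hK, hle⟩ := exists_lintegral_fderiv_iterate_le hC.1 hF hpos hl'
    (interior_subset he) hbdd x
  have hmeas : ∀ n, Measurable fun t : ℝ => l (fderiv ℝ (F^[n]) (x + t • e) e) := fun n =>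
    (l.continuous.comp (((hF.continuous_fderiv_iterate n).comp (by fun_prop)).clm_apply
      continuous_const)).measurable
  filter_upwards [ae_exists_le_sq_of_lintegral_le hmeas hK hle] with t ⟨B, hB, hgB⟩
  obtain ⟨D, hD, hDle⟩ := exists_norm_fderiv_iterate_le hC.1 hF hcpt hpos hl hl' he
    (hbdd (x + t • e))
  refine not_liminf_pos_of_ascents_le (fun n => norm_nonneg _) (D := D * B) fun n hn => ?_
  refine (hDle n hn).trans ?_
  rw [mul_assoc]
  refine mul_le_mul_of_nonneg_left ((hgB (n + 2)).trans_eq ?_) hD.le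
  push_cast
  ring

lemma lambdaMax_eq_zero_of_subsingleton [Subsingleton X] (F : X → X) (x : X) :
    lambdaMax F x = 0 := by
  have h : ∀ n : ℕ, ‖fderiv ℝ (F^[n]) x‖ = 0 := fun n => by
    rw [Subsingleton.elim (fderiv ℝ (F^[n]) x) 0, norm_zero]
  simp [lambdaMax, h]

end Iterates

/-- **Theorem A** (No observable chaos for monotone mappings).
For a compact `C¹` strongly monotone map (strongly positive derivative) on a strongly
ordered separable Banach space which is pointwise dissipative with attractor `A`,
the set `S₀ = {x : λ_max(x,F₀) > 0}` is shy. -/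
theorem no_observable_chaos_monotone_maps
    {X : Type*} [NormedAddCommGroup X] [NormedSpace ℝ X] [CompleteSpace X]
    [TopologicalSpace.SeparableSpace X] [MeasurableSpace X] [BorelSpace X]
    (C : Set X) (hC : StronglyOrderedCone C)
    (F₀ : X → X) (hC1 : ContDiff ℝ 1 F₀) (hcpt : IsCompactMap F₀)
    (hpos : ∀ x : X, StronglyPositive C (fderiv ℝ F₀ x))
    (hdiss : PointwiseDissipative F₀)
    (A : Set X) (hA : IsAttractor F₀ A) :
    IsShy {x : X | 0 < lambdaMax F₀ x} := by
  have hmeas : MeasurableSet {x : X | 0 < lambdaMax F₀ x} :=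
    measurableSet_lt measurable_const (measurable_lambdaMax hC1)
  refine ⟨hmeas, ?_⟩
  obtain ⟨e, he⟩ := hC.2
  have hcont : Continuous fun t : ℝ => t • e := by fun_prop
  have hsegcpt : IsCompact ((fun t : ℝ => t • e) '' Icc 0 1) := isCompact_Icc.image hcont
  refine ⟨(volume.restrict (Icc (0 : ℝ) 1)).map fun t => t • e, ?_,
    ⟨_, hsegcpt, ?_⟩, fun x => ?_⟩
  · rw [Ne, Measure.map_eq_zero_iff hcont.measurable.aemeasurable, Measure.restrict_eq_zero]
    simp
  · rw [Measure.map_apply hcont.measurable hsegcpt.measurableSet.compl,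
      Measure.restrict_apply (hcont.measurable hsegcpt.measurableSet.compl)]
    convert measure_empty (μ := (volume : Measure ℝ))
    exact eq_empty_of_forall_notMem fun t ht => ht.1 ⟨t, ht.2, rfl⟩
  · rcases subsingleton_or_nontrivial X with hX | hX
    · simp [lambdaMax_eq_zero_of_subsingleton]
    · rw [image_add_left, Measure.map_apply hcont.measurable
        (hmeas.preimage (measurable_const_add _))]
      exact measure_eq_zero_iff_ae_notMem.2
        (ae_not_lambdaMax_pos hC hC1 hcpt hpos hdiss.isBounded_orbit he (-x))

end
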